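/- A topological space X is locally strongly sober if and only if X is weakly Hausdorff, coherent, and sober. -/

import Mathlib

/-- The specialization preorder: `x ≤ y` iff every open neighborhood of `x` contains `y`. -/
def SpecLE {X : Type*} [TopologicalSpace X] (x y : X) : Prop :=
  ∀ U : Set X, IsOpen U → x ∈ U → y ∈ U

/-- `↑x`, the upward closure of the point `x` in the specialization preorder. -/
def UpSet {X : Type*} [TopologicalSpace X] (x : X) : Set X :=
  {z | SpecLE x z}

/-- `↑A`, the upward closure of the set `A` in the specialization preorder. -/
def UpClo {X : Type*} [TopologicalSpace X] (A : Set X) : Set X :=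
  {z | ∃ a ∈ A, SpecLE a z}

/-- `↓A`, the downward closure of the set `A` in the specialization preorder. -/
def DownClo {X : Type*} [TopologicalSpace X] (A : Set X) : Set X :=
  {z | ∃ a ∈ A, SpecLE z a}

/-- A space is weakly Hausdorff (Keimel-Lawson) iff every open neighborhood `W` of
`↑x ∩ ↑y` contains `U ∩ V` for some open neighborhoods `U` of `x` and `V` of `y`. -/
def WeaklyHausdorff (X : Type*) [TopologicalSpace X] : Prop :=
  ∀ x y : X, ∀ W : Set X, IsOpen W → UpSet x ∩ UpSet y ⊆ W →
    ∃ U V : Set X, IsOpen U ∧ x ∈ U ∧ IsOpen V ∧ y ∈ V ∧ U ∩ V ⊆ W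

/-- The set of limits of a filter: points all of whose open neighborhoods belong to it. -/
def limSet {X : Type*} [TopologicalSpace X] (F : Filter X) : Set X :=
  {x | ∀ U : Set X, IsOpen U → x ∈ U → U ∈ F}

/-- Locally strongly sober: limits of each ultrafilter form the empty set or the closure
of a unique point. -/
def LocallyStronglySober (X : Type*) [TopologicalSpace X] : Prop :=
  ∀ 𝒰 : Ultrafilter X, limSet (𝒰 : Filter X) = ∅ ∨ ∃! x : X, limSet (𝒰 : Filter X) = closure {x}

/-- Saturated subset: intersection of its open neighborhoods. -/
def IsSaturated {X : Type*} [TopologicalSpace X] (A : Set X) : Prop :=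
  A = ⋂₀ {U : Set X | IsOpen U ∧ A ⊆ U}

/-- Coherent space: intersections of compact saturated subsets are compact. -/
def Coherent (X : Type*) [TopologicalSpace X] : Prop :=
  ∀ Q₁ Q₂ : Set X, IsCompact Q₁ → IsSaturated Q₁ → IsCompact Q₂ → IsSaturated Q₂ →
    IsCompact (Q₁ ∩ Q₂)

/-- Weakly coherent space: `↑x ∩ ↑y` is compact for all points `x`, `y`. -/
def WeaklyCoherent (X : Type*) [TopologicalSpace X] : Prop :=
  ∀ x y : X, IsCompact (UpSet x ∩ UpSet y)

/-- Sober space: every irreducible closed subset is the closure of a unique point. -/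
def Sober (X : Type*) [TopologicalSpace X] : Prop :=
  ∀ C : Set X, IsClosed C → IsIrreducible C → ∃! x : X, C = closure {x}

/-- `z` is a supremum of `D` with respect to the specialization preorder. -/
def IsSupOf {X : Type*} [TopologicalSpace X] (D : Set X) (z : X) : Prop :=
  (∀ d ∈ D, SpecLE d z) ∧ ∀ y : X, (∀ d ∈ D, SpecLE d y) → SpecLE z y

/-- `D` is (nonempty and) directed with respect to the specialization preorder. -/
def DirectedSubset {X : Type*} [TopologicalSpace X] (D : Set X) : Prop :=
  D.Nonempty ∧ DirectedOn SpecLE D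

/-- Monotone convergence space: a T0 space where every directed subset has a supremum for the
specialization ordering, and every open set is Scott-open. -/
def MonotoneConvergenceSpace (X : Type*) [TopologicalSpace X] : Prop :=
  T0Space X ∧ (∀ D : Set X, DirectedSubset D → ∃ z : X, IsSupOf D z) ∧
    ∀ U : Set X, IsOpen U → ∀ D : Set X, ∀ z : X,
      DirectedSubset D → IsSupOf D z → z ∈ U → ∃ d ∈ D, d ∈ U

/-- A filter on a complete lattice: nonempty, upward closed, downward directed. -/
def IsLatFilter {L : Type*} [CompleteLattice L] (F : Set L) : Prop :=
  F.Nonempty ∧ (∀ u ∈ F, ∀ v : L, u ≤ v → v ∈ F) ∧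
    ∀ u ∈ F, ∀ v ∈ F, ∃ w ∈ F, w ≤ u ∧ w ≤ v

/-- A Scott-open filter on a complete lattice. -/
def ScottOpenFilter {L : Type*} [CompleteLattice L] (F : Set L) : Prop :=
  IsLatFilter F ∧
    ∀ D : Set L, D.Nonempty → DirectedOn (· ≤ ·) D → sSup D ∈ F → ∃ d ∈ D, d ∈ F

/-- The join of two filters on a complete lattice: `{u ⊓ v | u ∈ F, v ∈ G}`. -/
def FilterJoin {L : Type*} [CompleteLattice L] (F G : Set L) : Set L :=
  {w | ∃ u ∈ F, ∃ v ∈ G, w = u ⊓ v}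

/-- Locally temperate: the join of any two Scott-open filters is a Scott-open filter. -/
def LocallyTemperate (L : Type*) [CompleteLattice L] : Prop :=
  ∀ F G : Set L, ScottOpenFilter F → ScottOpenFilter G → ScottOpenFilter (FilterJoin F G)

/-- `u` is way below `v`: every directed set with supremum above `v` contains an element above `u`. -/
def WayBelowL {L : Type*} [CompleteLattice L] (u v : L) : Prop :=
  ∀ D : Set L, D.Nonempty → DirectedOn (· ≤ ·) D → v ≤ sSup D → ∃ d ∈ D, u ≤ d

/-- Continuous lattice: every element is the supremum of a directed family of elements
way below it. -/
def ContinuousLat (L : Type*) [CompleteLattice L] : Prop :=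
  ∀ v : L, ∃ D : Set L, D.Nonempty ∧ DirectedOn (· ≤ ·) D ∧ (∀ d ∈ D, WayBelowL d v) ∧ v = sSup D

/-- Stable frame: `u ≪ v` and `u ≪ w` imply `u ≪ v ⊓ w`. -/
def StableLat (L : Type*) [CompleteLattice L] : Prop :=
  ∀ u v w : L, WayBelowL u v → WayBelowL u w → WayBelowL u (v ⊓ w)

/-- Core-compact space: the frame of open subsets is a continuous lattice. -/
def CoreCompact (X : Type*) [TopologicalSpace X] : Prop :=
  ContinuousLat (TopologicalSpace.Opens X)

/-- A lens: a nonempty set of the form `Q ∩ C` with `Q` compact saturated and `C` closed. -/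
def IsLens {X : Type*} [TopologicalSpace X] (L : Set X) : Prop :=
  L.Nonempty ∧ ∃ Q C : Set X, IsCompact Q ∧ IsSaturated Q ∧ IsClosed C ∧ L = Q ∩ C

/-- A quasi-lens: a pair `(Q, C)`, `Q` compact saturated, `C` closed, `Q` meets `C`,
`Q ⊆ ↑(Q ∩ C)`, and `C ⊆ cl (U ∩ C)` for every open neighborhood `U` of `Q`. -/
def IsQuasiLens {X : Type*} [TopologicalSpace X] (Q C : Set X) : Prop :=
  IsCompact Q ∧ IsSaturated Q ∧ IsClosed C ∧ (Q ∩ C).Nonempty ∧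
    Q ⊆ UpClo (Q ∩ C) ∧ ∀ U : Set X, IsOpen U → Q ⊆ U → C ⊆ closure (U ∩ C)

theorem specLE_iff_specializes {X : Type*} [TopologicalSpace X] {x y : X} :
    SpecLE x y ↔ y ⤳ x :=
  specializes_iff_forall_open.symm

theorem mem_limSet_iff {X : Type*} [TopologicalSpace X] {F : Filter X} {x : X} :
    x ∈ limSet F ↔ F ≤ nhds x := by
  rw [le_nhds_iff]
  exact ⟨fun h s hx hs => h s hs hx, fun h s hs hx => h s hx hs⟩

theorem isClosed_limSet {X : Type*} [TopologicalSpace X] (F : Filter X) :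
    IsClosed (limSet F) := by
  refine isClosed_of_closure_subset fun x hx U hU hxU => ?_
  obtain ⟨y, hyU, hy⟩ := mem_closure_iff.1 hx U hU hxU
  exact hy U hU hyU

theorem IsSaturated.mem_of_specLE {X : Type*} [TopologicalSpace X] {A : Set X}
    (hA : IsSaturated A) {x y : X} (hx : x ∈ A) (hxy : SpecLE x y) : y ∈ A := by
  rw [hA]
  exact fun U hU => hxy U hU.1 (hU.2 hx)

theorem isSaturated_upSet {X : Type*} [TopologicalSpace X] (x : X) :
    IsSaturated (UpSet x) := by
  refine Set.Subset.antisymm (fun z hz U hU => hU.2 hz) fun z hz U hU hxU => ?_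
  exact hz U ⟨hU, fun y hy => hy U hU hxU⟩

theorem isCompact_upSet {X : Type*} [TopologicalSpace X] (x : X) : IsCompact (UpSet x) := by
  refine isCompact_iff_ultrafilter_le_nhds'.2 fun 𝒰 h𝒰 => ?_
  refine ⟨x, fun U _ hxU => hxU, mem_limSet_iff.1 fun U hU hxU => ?_⟩
  exact Filter.mem_of_superset h𝒰 fun y hy => hy U hU hxU

/-- In a locally strongly sober space, every convergent ultrafilter has a largest limit. -/
theorem LocallyStronglySober.exists_greatest_limit {X : Type*} [TopologicalSpace X]
    (h : LocallyStronglySober X) (𝒰 : Ultrafilter X)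
    (hne : (limSet (𝒰 : Filter X)).Nonempty) :
    ∃ z ∈ limSet (𝒰 : Filter X), ∀ x ∈ limSet (𝒰 : Filter X), SpecLE x z := by
  rcases h 𝒰 with h | ⟨z, hz, -⟩
  · exact absurd h hne.ne_empty
  · refine ⟨z, hz ▸ subset_closure rfl, fun x hx => ?_⟩
    rw [hz] at hx
    exact specLE_iff_specializes.2 (specializes_iff_mem_closure.2 hx)

theorem LocallyStronglySober.weaklyHausdorff {X : Type*} [TopologicalSpace X]
    (h : LocallyStronglySober X) : WeaklyHausdorff X := by
  intro x y W hW hxy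
  have hmem : W ∈ nhds x ⊓ nhds y := by
    refine Filter.mem_iff_ultrafilter.2 fun 𝒰 h𝒰 => ?_
    have hx : x ∈ limSet (𝒰 : Filter X) := mem_limSet_iff.2 (h𝒰.trans inf_le_left)
    have hy : y ∈ limSet (𝒰 : Filter X) := mem_limSet_iff.2 (h𝒰.trans inf_le_right)
    obtain ⟨z, hz, hle⟩ := h.exists_greatest_limit 𝒰 ⟨x, hx⟩
    exact hz W hW (hxy ⟨hle x hx, hle y hy⟩)
  obtain ⟨⟨U, V⟩, ⟨⟨hxU, hU⟩, hyV, hV⟩, hUV⟩ :=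
    ((nhds_basis_opens x).inf (nhds_basis_opens y)).mem_iff.1 hmem
  exact ⟨U, V, hU, hxU, hV, hyV, hUV⟩

theorem LocallyStronglySober.coherent {X : Type*} [TopologicalSpace X]
    (h : LocallyStronglySober X) : Coherent X := by
  intro Q₁ Q₂ hc₁ hs₁ hc₂ hs₂
  refine isCompact_iff_ultrafilter_le_nhds'.2 fun 𝒰 h𝒰 => ?_
  obtain ⟨x, hxQ, hx⟩ := isCompact_iff_ultrafilter_le_nhds'.1 hc₁ 𝒰
    (Filter.mem_of_superset h𝒰 Set.inter_subset_left)
  obtain ⟨y, hyQ, hy⟩ := isCompact_iff_ultrafilter_le_nhds'.1 hc₂ 𝒰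
    (Filter.mem_of_superset h𝒰 Set.inter_subset_right)
  rw [← mem_limSet_iff] at hx hy
  obtain ⟨z, hz, hle⟩ := h.exists_greatest_limit 𝒰 ⟨x, hx⟩
  exact ⟨z, ⟨hs₁.mem_of_specLE hxQ (hle x hx), hs₂.mem_of_specLE hyQ (hle y hy)⟩,
    mem_limSet_iff.1 hz⟩

/-- Every irreducible closed set is the set of limits of some ultrafilter. -/
theorem exists_ultrafilter_limSet_eq {X : Type*} [TopologicalSpace X] {C : Set X}
    (hC : IsClosed C) (hirr : IsIrreducible C) :
    ∃ 𝒰 : Ultrafilter X, limSet (𝒰 : Filter X) = C := by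
  obtain ⟨⟨c, hc⟩, hpre⟩ := hirr
  let F : Filter X :=
    { sets := {s | ∃ U, IsOpen U ∧ (C ∩ U).Nonempty ∧ C ∩ U ⊆ s}
      univ_sets := ⟨Set.univ, isOpen_univ, ⟨c, hc, trivial⟩, Set.subset_univ _⟩
      sets_of_superset := fun ⟨U, hU, hne, hs⟩ hst => ⟨U, hU, hne, hs.trans hst⟩
      inter_sets := fun ⟨U, hU, hUne, hUs⟩ ⟨V, hV, hVne, hVt⟩ =>
        ⟨U ∩ V, hU.inter hV, hpre U V hU hV hUne hVne,
          fun _ hx => ⟨hUs ⟨hx.1, hx.2.1⟩, hVt ⟨hx.1, hx.2.2⟩⟩⟩ }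
  have hF : F.NeBot := Filter.neBot_iff.2 fun hbot => by
    obtain ⟨U, -, hne, hs⟩ : ∅ ∈ F := hbot ▸ Filter.mem_bot
    exact (hne.mono hs).ne_empty rfl
  have hCF : C ∈ F := ⟨Set.univ, isOpen_univ, ⟨c, hc, trivial⟩, Set.inter_subset_left⟩
  refine ⟨Ultrafilter.of F, Set.Subset.antisymm (fun x hx => ?_) fun x hx U hU hxU => ?_⟩
  · exact isClosed_iff_ultrafilter.1 hC x _ (mem_limSet_iff.1 hx) (Ultrafilter.of_le F hCF)
  · exact Ultrafilter.of_le F ⟨U, hU, ⟨x, hx, hxU⟩, Set.inter_subset_right⟩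

theorem LocallyStronglySober.sober {X : Type*} [TopologicalSpace X]
    (h : LocallyStronglySober X) : Sober X := by
  intro C hC hirr
  obtain ⟨𝒰, rfl⟩ := exists_ultrafilter_limSet_eq hC hirr
  exact (h 𝒰).resolve_left hirr.nonempty.ne_empty

/-- If all open neighborhoods of a compact set belong to an ultrafilter, then the ultrafilter
has a limit in that set. -/
theorem IsCompact.exists_mem_limSet {X : Type*} [TopologicalSpace X] {Q : Set X}
    (hQ : IsCompact Q) (𝒰 : Ultrafilter X) (h : ∀ W, IsOpen W → Q ⊆ W → W ∈ 𝒰) :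
    ∃ z ∈ Q, z ∈ limSet (𝒰 : Filter X) := by
  by_contra! hno
  have hex : ∀ z ∈ Q, ∃ W, IsOpen W ∧ z ∈ W ∧ W ∉ 𝒰 := fun z hz => by
    simpa [limSet] using hno z hz
  choose! W hWo hzW hW using hex
  obtain ⟨t, htQ, hcov⟩ := hQ.elim_nhds_subcover W fun z hz => (hWo z hz).mem_nhds (hzW z hz)
  have hmem := h _ (isOpen_biUnion fun z hz => hWo z (htQ z hz)) hcov
  obtain ⟨z, hz, hzU⟩ := (Ultrafilter.finite_biUnion_mem_iff t.finite_toSet).1 hmem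
  exact hW z (htQ z hz) hzU

theorem WeaklyHausdorff.locallyStronglySober {X : Type*} [TopologicalSpace X]
    (hwh : WeaklyHausdorff X) (hcoh : Coherent X) (hsob : Sober X) :
    LocallyStronglySober X := by
  intro 𝒰
  refine (Set.eq_empty_or_nonempty _).imp_right fun hne => hsob _ (isClosed_limSet _) ⟨hne, ?_⟩
  rintro U V hU hV ⟨x, hx, hxU⟩ ⟨y, hy, hyV⟩
  have hQ : IsCompact (UpSet x ∩ UpSet y) :=
    hcoh _ _ (isCompact_upSet x) (isSaturated_upSet x) (isCompact_upSet y) (isSaturated_upSet y)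
  obtain ⟨z, ⟨hxz, hyz⟩, hz⟩ := hQ.exists_mem_limSet 𝒰 fun W hW hxyW => by
    obtain ⟨U', V', hU', hxU', hV', hyV', hsub⟩ := hwh x y W hW hxyW
    exact Filter.mem_of_superset (Filter.inter_mem (hx U' hU' hxU') (hy V' hV' hyV')) hsub
  exact ⟨z, hz, hxz U hU hxU, hyz V hV hyV⟩

theorem lss_iff_weaklyHausdorff_coherent_sober (X : Type*) [TopologicalSpace X] :
    LocallyStronglySober X ↔ (WeaklyHausdorff X ∧ Coherent X ∧ Sober X) :=
  ⟨fun h => ⟨h.weaklyHausdorff, h.coherent, h.sober⟩,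
    fun ⟨hwh, hcoh, hsob⟩ => hwh.locallyStronglySober hcoh hsob⟩
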